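/- Assume the KKT system has a solution, let {(x^k,y^k,z^k)}_{k≥0} be an infinite sequence generated by the sPADMM, and assume Condition (C) holds. If in addition Σ_f + A A* + S and Σ_g + B B* + T are positive definite, then each sPADMM subproblem (minimization in y and in z at every iteration) has a unique optimal solution, and the whole sequence {(x^k,y^k,z^k)} converges to a triple (x^∞,y^∞,z^∞) that solves the KKT system. -/

import Mathlib

open scoped RealInnerProductSpace
open Filter Bornology

noncomputable section

variable {X Y Z : Type*}
variable [NormedAddCommGroup X] [InnerProductSpace ℝ X] [FiniteDimensional ℝ X]
variable [NormedAddCommGroup Y] [InnerProductSpace ℝ Y] [FiniteDimensional ℝ Y]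
variable [NormedAddCommGroup Z] [InnerProductSpace ℝ Z] [FiniteDimensional ℝ Z]

/-- `f : E → ℝ ∪ {+∞}` is proper, convex and lower semicontinuous. -/
def ProperConvexLsc {E : Type*} [NormedAddCommGroup E] [InnerProductSpace ℝ E]
    (f : E → EReal) : Prop :=
  (∃ u, f u ≠ ⊤) ∧ (∀ u, f u ≠ ⊥) ∧
    (∀ u v : E, ∀ a b : ℝ, 0 ≤ a → 0 ≤ b → a + b = 1 →
      f (a • u + b • v) ≤ (a : EReal) * f u + (b : EReal) * f v) ∧
    LowerSemicontinuous f

/-- `frec` is the recession function of `f`:  for any `u₀` in the effective domain of `f`,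
`frec u = lim_{ρ → +∞} (f (u₀ + ρ u) - f u₀) / ρ`. -/
def IsRecessionFn {E : Type*} [NormedAddCommGroup E] [InnerProductSpace ℝ E]
    (f : E → EReal) (frec : E → EReal) : Prop :=
  ∀ u₀ : E, f u₀ ≠ ⊤ → ∀ u : E,
    Tendsto (fun ρ : ℝ => (f (u₀ + ρ • u) - f u₀) * ((ρ⁻¹ : ℝ) : EReal))
      atTop (nhds (frec u))

/-- The augmented Lagrangian `L_σ(y, z; x)` of the problem
`min f(y) + g(z)  s.t.  A* y + B* z = c`. -/
def augL (f : Y → EReal) (g : Z → EReal) (A : X →ₗ[ℝ] Y) (B : X →ₗ[ℝ] Z)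
    (c : X) (σ : ℝ) (y : Y) (z : Z) (x : X) : EReal :=
  f y + g z + ((⟪x, (LinearMap.adjoint A) y + (LinearMap.adjoint B) z - c⟫ : ℝ) : EReal)
    + ((σ / 2 * ‖(LinearMap.adjoint A) y + (LinearMap.adjoint B) z - c‖ ^ 2 : ℝ) : EReal)

/-- Objective of the `y`-subproblem:  `F(w) = L_σ(w, z'; x') + (1/2) ‖w - y'‖_S²`. -/
def ysub (f : Y → EReal) (g : Z → EReal) (A : X →ₗ[ℝ] Y) (B : X →ₗ[ℝ] Z)
    (c : X) (σ : ℝ) (S : Y →ₗ[ℝ] Y) (x' : X) (y' : Y) (z' : Z) (w : Y) : EReal :=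
  augL f g A B c σ w z' x' + ((⟪w - y', S (w - y')⟫ / 2 : ℝ) : EReal)

/-- Objective of the `z`-subproblem:  `G(w) = L_σ(y', w; x') + (1/2) ‖w - z'‖_T²`. -/
def zsub (f : Y → EReal) (g : Z → EReal) (A : X →ₗ[ℝ] Y) (B : X →ₗ[ℝ] Z)
    (c : X) (σ : ℝ) (T : Z →ₗ[ℝ] Z) (x' : X) (y' : Y) (z' : Z) (w : Z) : EReal :=
  augL f g A B c σ y' w x' + ((⟪w - z', T (w - z')⟫ / 2 : ℝ) : EReal)

/-- The subdifferential `∂f(u)` of a function `f : E → ℝ ∪ {+∞}`. -/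
def subdiff {E : Type*} [NormedAddCommGroup E] [InnerProductSpace ℝ E]
    (f : E → EReal) (u : E) : Set E :=
  {v | ∀ w : E, f u + ((⟪v, w - u⟫ : ℝ) : EReal) ≤ f w}

/-- `(x, y, z) : ℕ → X × Y × Z` is a sequence generated by the sPADMM scheme with
penalty parameter `σ`, step-length `τ` and proximal terms given by `S` and `T`,
started from an initial point `(x⁰, y⁰, z⁰) ∈ X × dom f × dom g`. -/
def IsSPADMM (f : Y → EReal) (g : Z → EReal) (A : X →ₗ[ℝ] Y) (B : X →ₗ[ℝ] Z)
    (c : X) (σ τ : ℝ) (S : Y →ₗ[ℝ] Y) (T : Z →ₗ[ℝ] Z)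
    (x : ℕ → X) (y : ℕ → Y) (z : ℕ → Z) : Prop :=
  f (y 0) ≠ ⊤ ∧ g (z 0) ≠ ⊤ ∧
    (∀ k : ℕ, ∀ w : Y,
      ysub f g A B c σ S (x k) (y k) (z k) (y (k + 1))
        ≤ ysub f g A B c σ S (x k) (y k) (z k) w) ∧
    (∀ k : ℕ, ∀ w : Z,
      zsub f g A B c σ T (x k) (y (k + 1)) (z k) (z (k + 1))
        ≤ zsub f g A B c σ T (x k) (y (k + 1)) (z k) w) ∧
    (∀ k : ℕ, x (k + 1) = x k + (τ * σ) •
      ((LinearMap.adjoint A) (y (k + 1)) + (LinearMap.adjoint B) (z (k + 1)) - c))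

/-- `(x̄, ȳ, z̄)` solves the KKT system:
`-A x̄ ∈ ∂f(ȳ)`, `-B x̄ ∈ ∂g(z̄)` and `A* ȳ + B* z̄ = c`. -/
def IsKKT (f : Y → EReal) (g : Z → EReal) (A : X →ₗ[ℝ] Y) (B : X →ₗ[ℝ] Z)
    (c : X) (xb : X) (yb : Y) (zb : Z) : Prop :=
  -(A xb) ∈ subdiff f yb ∧ -(B xb) ∈ subdiff g zb ∧
    (LinearMap.adjoint A) yb + (LinearMap.adjoint B) zb = c

/-- Condition (C): either `0 < τ < (1+√5)/2`, or `τ ≥ (1+√5)/2` and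
`Σ_k ‖x^{k+1} - x^k‖² < ∞`. -/
def CondC {X : Type*} [NormedAddCommGroup X] (τ : ℝ) (x : ℕ → X) : Prop :=
  (0 < τ ∧ τ < (1 + Real.sqrt 5) / 2) ∨
    ((1 + Real.sqrt 5) / 2 ≤ τ ∧ Summable fun k : ℕ => ‖x (k + 1) - x k‖ ^ 2)

/-- `Sf` satisfies `⟨v - v', u - u'⟩ ≥ ‖u - u'‖²_{Sf}` for all `v ∈ ∂f(u)`, `v' ∈ ∂f(u')`. -/
def SubMono {E : Type*} [NormedAddCommGroup E] [InnerProductSpace ℝ E]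
    (f : E → EReal) (Sf : E →ₗ[ℝ] E) : Prop :=
  ∀ u u' v v' : E, v ∈ subdiff f u → v' ∈ subdiff f u' →
    ⟪u - u', Sf (u - u')⟫ ≤ ⟪v - v', u - u'⟫

section Auxiliary

variable {E : Type*} [NormedAddCommGroup E] [InnerProductSpace ℝ E]

/-- A minimizer of `f + q`, where `q` has the directional expansion
`q (u + t d) = q u + t ⟪p, d⟫ + O(t²)`, satisfies `-p ∈ ∂f(u)`. -/
lemma neg_mem_subdiff_of_isMin {f : E → EReal} (hf : ProperConvexLsc f) {q : E → ℝ} {u p : E}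
    (hu : f u ≠ ⊤) (hmin : ∀ w, f u + (q u : EReal) ≤ f w + (q w : EReal))
    (hq : ∀ d : E, ∃ K : ℝ, ∀ t : ℝ, q (u + t • d) = q u + t * ⟪p, d⟫ + t ^ 2 * K) :
    -p ∈ subdiff f u := by
  obtain ⟨-, hbot, hconv, -⟩ := hf
  intro w
  by_cases hw : f w = ⊤
  · rw [hw]; exact le_top
  obtain ⟨K, hK⟩ := hq (w - u)
  lift f u to ℝ using ⟨hu, hbot u⟩ with a ha
  lift f w to ℝ using ⟨hw, hbot w⟩ with b hb
  rw [inner_neg_left]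
  norm_cast
  have key : ∀ t : ℝ, 0 < t → t ≤ 1 → 0 ≤ (b - a + ⟪p, w - u⟫) + t * K := by
    intro t ht ht1
    have h1 := hconv u w (1 - t) t (by linarith) ht.le (by ring)
    have h2 := hmin (u + t • (w - u))
    rw [show (1 - t) • u + t • w = u + t • (w - u) by module, ← ha, ← hb] at h1
    have h3 : f (u + t • (w - u)) ≠ ⊤ := by
      intro h
      rw [h] at h1
      norm_cast at h1
    lift f (u + t • (w - u)) to ℝ using ⟨h3, hbot _⟩ with m hm
    norm_cast at h1 h2
    rw [hK t] at h2
    have h4 : 0 ≤ t * ((b - a + ⟪p, w - u⟫) + t * K) := by nlinarith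
    exact nonneg_of_mul_nonneg_right h4 ht
  have hlim : Tendsto (fun t : ℝ => (b - a + ⟪p, w - u⟫) + t * K) (nhdsWithin 0 (Set.Ioi 0))
      (nhds ((b - a + ⟪p, w - u⟫) + 0 * K)) :=
    (Continuous.tendsto (by fun_prop) 0).mono_left nhdsWithin_le_nhds
  have h0 := ge_of_tendsto hlim (by
    filter_upwards [Ioc_mem_nhdsGT (zero_lt_one' ℝ)] with t ht using key t ht.1 ht.2)
  linarith

/-- The graph of the subdifferential of a lower semicontinuous function is closed. -/
lemma mem_subdiff_of_tendsto {f : E → EReal} (hf : LowerSemicontinuous f)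
    {u v : ℕ → E} {u₀ v₀ : E} (hu : Tendsto u atTop (nhds u₀)) (hv : Tendsto v atTop (nhds v₀))
    (h : ∀ n, v n ∈ subdiff f (u n)) : v₀ ∈ subdiff f u₀ := by
  intro w
  have hinner : Tendsto (fun n => (⟪v n, w - u n⟫ : ℝ)) atTop (nhds ⟪v₀, w - u₀⟫) :=
    hv.inner (tendsto_const_nhds.sub hu)
  by_cases hw : f w = ⊤
  · rw [hw]; exact le_top
  have hlim : Tendsto (fun n => f w + ((-⟪v n, w - u n⟫ : ℝ) : EReal)) atTop
      (nhds (f w + ((-⟪v₀, w - u₀⟫ : ℝ) : EReal))) :=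
    (EReal.continuousAt_add (p := (f w, ((-⟪v₀, w - u₀⟫ : ℝ) : EReal)))
      (Or.inl hw) (Or.inr (EReal.coe_ne_top _))).tendsto.comp
      (tendsto_const_nhds.prodMk_nhds
        ((continuous_coe_real_ereal.tendsto _).comp hinner.neg))
  rw [← EReal.le_sub_iff_add_le (by simp) (by simp), sub_eq_add_neg, ← EReal.coe_neg]
  by_contra! hlt
  obtain ⟨m, hm₁, hm₂⟩ := exists_between hlt
  obtain ⟨n, hn₁, hn₂⟩ :=
    ((hlim.eventually_lt_const hm₁).and (hu.eventually (hf u₀ m hm₂))).exists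
  have hle := (EReal.le_sub_iff_add_le (by simp) (by simp)).2 (h n w)
  rw [sub_eq_add_neg, ← EReal.coe_neg] at hle
  exact absurd (hn₂.trans_le (hle.trans hn₁.le)) (lt_irrefl m)

lemma inner_map_sub_self {M : E →ₗ[ℝ] E} (hM : M.IsSymmetric) (a b : E) :
    2 * ⟪M (a - b), a⟫ = ⟪a, M a⟫ - ⟪b, M b⟫ + ⟪a - b, M (a - b)⟫ := by
  have h := hM a b
  have h1 := real_inner_comm a (M a)
  have h2 := real_inner_comm a (M b)
  have h3 := real_inner_comm b (M a)
  simp only [map_sub, inner_sub_left, inner_sub_right]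
  linarith

/-- A positive definite quadratic form on a finite-dimensional space is coercive. -/
lemma exists_pos_mul_norm_sq_le [FiniteDimensional ℝ E] (M : E →ₗ[ℝ] E)
    (hM : ∀ w : E, w ≠ 0 → 0 < ⟪w, M w⟫) : ∃ m : ℝ, 0 < m ∧ ∀ w, m * ‖w‖ ^ 2 ≤ ⟪w, M w⟫ := by
  have hcont : Continuous fun w : E => (⟪w, M w⟫ : ℝ) :=
    continuous_id.inner M.continuous_of_finiteDimensional
  rcases (Metric.sphere (0 : E) 1).eq_empty_or_nonempty with h | h
  · refine ⟨1, one_pos, fun w => ?_⟩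
    have hw : w = 0 := by
      by_contra hw
      have : (‖w‖⁻¹ • w) ∈ Metric.sphere (0 : E) 1 := by simp [norm_smul, hw]
      simp [h] at this
    simp [hw]
  · obtain ⟨w₀, hw₀, hmin⟩ := (isCompact_sphere (0 : E) 1).exists_isMinOn h hcont.continuousOn
    have hne : w₀ ≠ 0 := by rintro rfl; simp at hw₀
    refine ⟨⟪w₀, M w₀⟫, hM w₀ hne, fun w => ?_⟩
    by_cases hw : w = 0
    · simp [hw]
    have hmem : (‖w‖⁻¹ • w) ∈ Metric.sphere (0 : E) 1 := by simp [norm_smul, hw]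
    have h1 : (⟪w₀, M w₀⟫ : ℝ) ≤ ⟪‖w‖⁻¹ • w, M (‖w‖⁻¹ • w)⟫ := hmin hmem
    rw [map_smul, inner_smul_left, inner_smul_right] at h1
    have hpos : 0 < ‖w‖ := norm_pos_iff.2 hw
    calc (⟪w₀, M w₀⟫ : ℝ) * ‖w‖ ^ 2 ≤ (‖w‖⁻¹ * (‖w‖⁻¹ * ⟪w, M w⟫)) * ‖w‖ ^ 2 := by
          gcongr; simpa using h1
      _ = ⟪w, M w⟫ := by field_simp

/-- For a positive semidefinite `M`, `⟪w n, M (w n)⟫ → 0` implies `M (w n) → 0`. -/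
lemma tendsto_map_zero_of_inner [FiniteDimensional ℝ E] {M : E →ₗ[ℝ] E} (hM : M.IsSymmetric)
    (hpsd : ∀ w : E, 0 ≤ ⟪w, M w⟫) {w : ℕ → E}
    (hw : Tendsto (fun n => (⟪w n, M (w n)⟫ : ℝ)) atTop (nhds 0)) :
    Tendsto (fun n => M (w n)) atTop (nhds 0) := by
  obtain ⟨C, hC0, hC⟩ := (LinearMap.toContinuousLinearMap M).isBoundedLinearMap.bound
  have hC' : ∀ v, ‖M v‖ ≤ C * ‖v‖ := hC
  have key : ∀ v : E, ‖M v‖ ^ 2 ≤ C * ⟪v, M v⟫ := by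
    intro v
    have h0 := hpsd (v - C⁻¹ • M v)
    have h1 : ⟪M v, M (M v)⟫ ≤ C * ‖M v‖ ^ 2 :=
      (real_inner_le_norm _ _).trans (by nlinarith [hC' (M v), norm_nonneg (M v)])
    have h2 := hM v (M v)
    simp only [map_sub, map_smul, inner_sub_left, inner_sub_right, inner_smul_left,
      inner_smul_right, real_inner_self_eq_norm_sq, ← h2, RCLike.conj_to_real] at h0
    have h3 : C⁻¹ * (C⁻¹ * ⟪M v, M (M v)⟫) ≤ C⁻¹ * (C⁻¹ * (C * ‖M v‖ ^ 2)) := by gcongr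
    have h4 : C⁻¹ * (C⁻¹ * (C * ‖M v‖ ^ 2)) = C⁻¹ * ‖M v‖ ^ 2 := by field_simp
    have h5 : C⁻¹ * ‖M v‖ ^ 2 ≤ ⟪v, M v⟫ := by linarith
    calc ‖M v‖ ^ 2 = C * (C⁻¹ * ‖M v‖ ^ 2) := by field_simp
      _ ≤ _ := by gcongr
  rw [tendsto_zero_iff_norm_tendsto_zero]
  have : Tendsto (fun n => ‖M (w n)‖ ^ 2) atTop (nhds 0) :=
    squeeze_zero (fun _ => by positivity) (fun n => key (w n)) (by simpa using hw.const_mul C)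
  simpa using this.sqrt

/-- A nonnegative sequence satisfying a perturbed descent inequality with summable
perturbation converges, and the decrements tend to zero. -/
lemma tendsto_of_perturbed_descent {a b e : ℕ → ℝ} (ha : ∀ n, 0 ≤ a n) (hb : ∀ n, 0 ≤ b n)
    (he : ∀ n, 0 ≤ e n) (hes : Summable e) (h : ∀ n, a (n + 1) + b n ≤ a n + e n) :
    (∃ l, Tendsto a atTop (nhds l)) ∧ Tendsto b atTop (nhds 0) := by
  have hsum : ∀ n, a n + ∑ i ∈ Finset.range n, b i ≤ a 0 + ∑ i ∈ Finset.range n, e i := by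
    intro n
    induction n with
    | zero => simp
    | succ n ih => rw [Finset.sum_range_succ, Finset.sum_range_succ]; linarith [h n]
  have hbs : Summable b := by
    refine summable_of_sum_range_le (c := a 0 + ∑' i, e i) hb fun n => ?_
    linarith [hsum n, ha n, hes.sum_le_tsum (Finset.range n) fun i _ => he i]
  refine ⟨?_, hbs.tendsto_atTop_zero⟩
  have hanti : Antitone fun n =>
      a n + ∑ i ∈ Finset.range n, b i - ∑ i ∈ Finset.range n, e i := by
    refine antitone_nat_of_succ_le fun n => ?_
    simp only [Finset.sum_range_succ]
    linarith [h n]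
  have hbdd : BddBelow (Set.range fun n =>
      a n + ∑ i ∈ Finset.range n, b i - ∑ i ∈ Finset.range n, e i) := by
    refine ⟨-∑' i, e i, ?_⟩
    rintro _ ⟨n, rfl⟩
    have := Finset.sum_nonneg fun i (_ : i ∈ Finset.range n) => hb i
    linarith [ha n, hes.sum_le_tsum (Finset.range n) fun i _ => he i]
  have hc := tendsto_atTop_ciInf hanti hbdd
  refine ⟨_, ((hc.sub hbs.hasSum.tendsto_sum_nat).add hes.hasSum.tendsto_sum_nat).congr
    fun n => ?_⟩
  ring

lemma ne_top_of_mem_subdiff {f : E → EReal} (hf : ProperConvexLsc f) {u v : E}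
    (h : v ∈ subdiff f u) : f u ≠ ⊤ := by
  obtain ⟨⟨w, hw⟩, -⟩ := hf
  intro hu
  have := h w
  rw [hu, EReal.top_add_coe, top_le_iff] at this
  exact hw this

lemma ne_top_of_add_coe_le {a b : EReal} {p q : ℝ} (hb : b ≠ ⊤)
    (h : a + (p : EReal) ≤ b + (q : EReal)) : a ≠ ⊤ := by
  rintro rfl
  rw [EReal.top_add_coe, top_le_iff] at h
  exact EReal.add_ne_top hb (EReal.coe_ne_top q) h

/-- The choice of weights in Young's inequality that makes the step-length bound
`τ < (1 + √5) / 2` work. -/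
lemma exists_young_weights {τ : ℝ} (hτ : 0 < τ) (hτ' : τ < (1 + Real.sqrt 5) / 2) :
    ∃ C δ : ℝ, 0 ≤ C ∧ 0 < δ ∧ C + δ ≤ 2 - τ ∧
      ∀ d r : E, 2 * ((1 - τ) * ⟪d, r⟫) ≤ (1 - δ) * ‖d‖ ^ 2 + C * ‖r‖ ^ 2 := by
  rcases le_or_gt τ 1 with h | h
  · refine ⟨1 - τ, τ, by linarith, hτ, by linarith, fun d r => ?_⟩
    have h1 := norm_sub_sq_real d r
    nlinarith [mul_nonneg (sub_nonneg.2 h) (sq_nonneg ‖d - r‖)]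
  · have h5 : Real.sqrt 5 ^ 2 = 5 := Real.sq_sqrt (by norm_num)
    have hκ : 0 < 1 + τ - τ ^ 2 := by nlinarith [Real.sqrt_nonneg 5]
    refine ⟨(τ - 1) / τ, (1 + τ - τ ^ 2) / τ, div_nonneg (by linarith) hτ.le, by positivity, ?_, fun d r => ?_⟩
    · rw [← add_div, div_le_iff₀ hτ]; nlinarith
    · have h1 := norm_add_sq_real (τ • d) r
      rw [norm_smul, real_inner_smul_left, Real.norm_eq_abs, mul_pow, sq_abs] at h1
      have h2 : 0 ≤ (τ - 1) / τ * ‖τ • d + r‖ ^ 2 := by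
        have : 0 ≤ τ - 1 := by linarith
        positivity
      rw [h1] at h2
      have h3 : (τ - 1) / τ * (τ ^ 2 * ‖d‖ ^ 2 + 2 * (τ * ⟪d, r⟫) + ‖r‖ ^ 2) =
        (τ - 1) * τ * ‖d‖ ^ 2 + 2 * ((τ - 1) * ⟪d, r⟫) + (τ - 1) / τ * ‖r‖ ^ 2 := by
        field_simp
      have h4 : (1 + τ - τ ^ 2) / τ ≤ 1 + τ - τ ^ 2 := div_le_self hκ.le h.le
      nlinarith [mul_le_mul_of_nonneg_right h4 (sq_nonneg ‖d‖)]

end Auxiliary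

section Subproblem

variable {E : Type*} [NormedAddCommGroup E] [InnerProductSpace ℝ E] [FiniteDimensional ℝ E]

/-- The smooth part of an sPADMM subproblem, up to an additive constant. -/
def proxQuad (A : X →ₗ[ℝ] E) (σ : ℝ) (M : E →ₗ[ℝ] E) (x b : X) (e w : E) : ℝ :=
  ⟪x, LinearMap.adjoint A w + b⟫ + σ / 2 * ‖LinearMap.adjoint A w + b‖ ^ 2 +
    ⟪w - e, M (w - e)⟫ / 2

lemma proxQuad_add_smul (A : X →ₗ[ℝ] E) (σ : ℝ) {M : E →ₗ[ℝ] E} (hM : M.IsSymmetric)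
    (x b : X) (e u d : E) (t : ℝ) :
    proxQuad A σ M x b e (u + t • d) = proxQuad A σ M x b e u +
      t * ⟪A (x + σ • (LinearMap.adjoint A u + b)) + M (u - e), d⟫ +
      t ^ 2 * (σ / 2 * ‖LinearMap.adjoint A d‖ ^ 2 + ⟪d, M d⟫ / 2) := by
  have h1 : LinearMap.adjoint A (u + t • d) + b =
      (LinearMap.adjoint A u + b) + t • LinearMap.adjoint A d := by
    rw [map_add, map_smul]; abel
  have h2 : u + t • d - e = (u - e) + t • d := by abel
  have h3 := hM (u - e) d
  have h4 : (⟪d, M (u - e)⟫ : ℝ) = ⟪M (u - e), d⟫ := real_inner_comm _ _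
  unfold proxQuad
  rw [h1, h2, norm_add_sq_real, norm_smul, mul_pow, Real.norm_eq_abs, sq_abs, map_add M, map_smul]
  simp only [inner_add_left, inner_add_right, real_inner_smul_left, real_inner_smul_right,
    ← LinearMap.adjoint_inner_right A, h4, ← h3]
  ring

lemma mem_subdiff_of_prox_isMin {f : E → EReal} (hf : ProperConvexLsc f) (A : X →ₗ[ℝ] E) (σ : ℝ)
    {M : E →ₗ[ℝ] E} (hM : M.IsSymmetric) (x b : X) (e : E) (G : ℝ) {u : E} (hu : f u ≠ ⊤)
    (hmin : ∀ w, f u + ((G + proxQuad A σ M x b e u : ℝ) : EReal) ≤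
      f w + ((G + proxQuad A σ M x b e w : ℝ) : EReal)) :
    -(A (x + σ • (LinearMap.adjoint A u + b))) - M (u - e) ∈ subdiff f u := by
  have := neg_mem_subdiff_of_isMin hf (q := fun w => G + proxQuad A σ M x b e w)
    (p := A (x + σ • (LinearMap.adjoint A u + b)) + M (u - e)) hu hmin
    fun d => ⟨_, fun t => by
      rw [proxQuad_add_smul A σ hM, add_assoc, add_assoc, add_assoc]⟩
  rwa [neg_add, ← sub_eq_add_neg] at this

lemma inner_neg_map_sub (A : X →ₗ[ℝ] E) (q : X) (s w : E) :
    (⟪-(A q) - s, w⟫ : ℝ) = -⟪q, LinearMap.adjoint A w⟫ - ⟪s, w⟫ := by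
  rw [inner_sub_left, inner_neg_left, LinearMap.adjoint_inner_right]

lemma inner_add_adjoint_add (A : X →ₗ[ℝ] E) (P M : E →ₗ[ℝ] E) (w : E) :
    (⟪w, (P + A ∘ₗ LinearMap.adjoint A + M) w⟫ : ℝ) =
      ⟪w, P w⟫ + ‖LinearMap.adjoint A w‖ ^ 2 + ⟪w, M w⟫ := by
  rw [LinearMap.add_apply, LinearMap.add_apply, inner_add_right, inner_add_right,
    LinearMap.comp_apply, ← LinearMap.adjoint_inner_left A, real_inner_self_eq_norm_sq]

/-- Under the positive definiteness assumption a subproblem has at most one solution. -/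
lemma eq_of_prox_mem_subdiff {f : E → EReal} (A : X →ₗ[ℝ] E) {σ : ℝ} (hσ : 0 < σ)
    {M : E →ₗ[ℝ] E} (hMpsd : ∀ w, 0 ≤ ⟪w, M w⟫) {P : E →ₗ[ℝ] E} (hPpsd : ∀ w, 0 ≤ ⟪w, P w⟫)
    (hP : SubMono f P)
    (hpd : ∀ w : E, w ≠ 0 → 0 < ⟪w, (P + A ∘ₗ LinearMap.adjoint A + M) w⟫)
    (x b : X) (e : E) {u u' : E}
    (hu : -(A (x + σ • (LinearMap.adjoint A u + b))) - M (u - e) ∈ subdiff f u)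
    (hu' : -(A (x + σ • (LinearMap.adjoint A u' + b))) - M (u' - e) ∈ subdiff f u') :
    u = u' := by
  by_contra hne
  have h1 := hP _ _ _ _ hu hu'
  have h2 : -(A (x + σ • (LinearMap.adjoint A u + b))) - M (u - e) -
      (-(A (x + σ • (LinearMap.adjoint A u' + b))) - M (u' - e)) =
      -(A (σ • LinearMap.adjoint A (u - u'))) - M (u - u') := by
    simp only [map_add, map_sub, map_smul, smul_add, smul_sub]; abel
  rw [h2, inner_neg_map_sub, real_inner_smul_left, real_inner_self_eq_norm_sq,
    real_inner_comm (u - u') (M (u - u'))] at h1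
  have h3 := hpd (u - u') (sub_ne_zero.2 hne)
  rw [inner_add_adjoint_add] at h3
  have h4 := hMpsd (u - u')
  have h5 := hPpsd (u - u')
  have h6 : σ * ‖LinearMap.adjoint A (u - u')‖ ^ 2 ≤ 0 := by linarith
  have h7 := nonpos_of_mul_nonpos_right h6 hσ
  linarith [mul_nonneg hσ.le (sq_nonneg ‖LinearMap.adjoint A (u - u')‖)]

lemma ysub_eq (f : Y → EReal) {g : Z → EReal} (A : X →ₗ[ℝ] Y) (B : X →ₗ[ℝ] Z) (c : X) (σ : ℝ)
    (S : Y →ₗ[ℝ] Y) (x : X) (y : Y) {z : Z} {G : ℝ} (hG : g z = G) (w : Y) :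
    ysub f g A B c σ S x y z w =
      f w + ((G + proxQuad A σ S x (LinearMap.adjoint B z - c) y w : ℝ) : EReal) := by
  simp only [ysub, augL, proxQuad, hG, EReal.coe_add, add_assoc, add_sub_assoc]

lemma zsub_eq {f : Y → EReal} (g : Z → EReal) (A : X →ₗ[ℝ] Y) (B : X →ₗ[ℝ] Z) (c : X) (σ : ℝ)
    (T : Z →ₗ[ℝ] Z) (x : X) {y : Y} (z : Z) {G : ℝ} (hG : f y = G) (w : Z) :
    zsub f g A B c σ T x y z w =
      g w + ((G + proxQuad B σ T x (LinearMap.adjoint A y - c) z w : ℝ) : EReal) := by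
  have h : LinearMap.adjoint A y + LinearMap.adjoint B w - c =
      LinearMap.adjoint B w + (LinearMap.adjoint A y - c) := by abel
  simp only [zsub, augL, proxQuad, hG, h, EReal.coe_add]
  rw [add_comm (G : EReal)]
  simp only [add_assoc]

end Subproblem

section Convergence

/-- The first-order optimality conditions satisfied by the sPADMM iterates. -/
structure SPADMMOptimality (f : Y → EReal) (g : Z → EReal) (A : X →ₗ[ℝ] Y) (B : X →ₗ[ℝ] Z)
    (c : X) (σ τ : ℝ) (S : Y →ₗ[ℝ] Y) (T : Z →ₗ[ℝ] Z)
    (x : ℕ → X) (y : ℕ → Y) (z : ℕ → Z) : Prop where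
  y_mem : ∀ k, -(A (x k + σ • (LinearMap.adjoint A (y (k + 1)) + (LinearMap.adjoint B (z k) - c))))
    - S (y (k + 1) - y k) ∈ subdiff f (y (k + 1))
  z_mem : ∀ k, -(B (x k + σ • (LinearMap.adjoint B (z (k + 1)) +
    (LinearMap.adjoint A (y (k + 1)) - c)))) - T (z (k + 1) - z k) ∈ subdiff g (z (k + 1))
  x_step : ∀ k, x (k + 1) = x k + (τ * σ) •
    (LinearMap.adjoint A (y (k + 1)) + LinearMap.adjoint B (z (k + 1)) - c)

/-- The Lyapunov function of the sPADMM relative to a reference point `(xb, yb, zb)`. -/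
def lyap (B : X →ₗ[ℝ] Z) (σ τ : ℝ) (S : Y →ₗ[ℝ] Y) (T : Z →ₗ[ℝ] Z)
    (xb : X) (yb : Y) (zb : Z) (x : X) (y : Y) (z : Z) : ℝ :=
  (τ * σ)⁻¹ * ‖x - xb‖ ^ 2 + ⟪y - yb, S (y - yb)⟫ + ⟪z - zb, T (z - zb)⟫ +
    σ * ‖LinearMap.adjoint B (z - zb)‖ ^ 2

/-- One step `(y, z) → (y', z')` of the sPADMM decreases the Lyapunov function up to a
cross term. -/
lemma lyap_step {f : Y → EReal} {g : Z → EReal} {A : X →ₗ[ℝ] Y} {B : X →ₗ[ℝ] Z} {c : X}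
    {σ τ : ℝ} (hσ : 0 < σ) (hτ : 0 < τ) {S : Y →ₗ[ℝ] Y} (hS : S.IsSymmetric)
    {T : Z →ₗ[ℝ] Z} (hT : T.IsSymmetric) {Sf : Y →ₗ[ℝ] Y} (hSf : SubMono f Sf)
    {Sg : Z →ₗ[ℝ] Z} (hSg : SubMono g Sg) {xb : X} {yb : Y} {zb : Z}
    (hkkt : IsKKT f g A B c xb yb zb) {x : X} {y y' : Y} {z z' : Z}
    (hv : -(A (x + σ • (LinearMap.adjoint A y' + (LinearMap.adjoint B z - c)))) - S (y' - y)
      ∈ subdiff f y')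
    (hw : -(B (x + σ • (LinearMap.adjoint B z' + (LinearMap.adjoint A y' - c)))) - T (z' - z)
      ∈ subdiff g z')
    {r : X} (hr : r = LinearMap.adjoint A y' + LinearMap.adjoint B z' - c) :
    lyap B σ τ S T xb yb zb (x + (τ * σ) • r) y' z' +
      2 * ⟪y' - yb, Sf (y' - yb)⟫ + 2 * ⟪z' - zb, Sg (z' - zb)⟫ + (2 - τ) * σ * ‖r‖ ^ 2 +
      ⟪y' - y, S (y' - y)⟫ + ⟪z' - z, T (z' - z)⟫ + σ * ‖LinearMap.adjoint B (z' - z)‖ ^ 2 -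
      2 * σ * ⟪LinearMap.adjoint B (z' - z), r⟫ ≤ lyap B σ τ S T xb yb zb x y z := by
  obtain ⟨hk1, hk2, hk3⟩ := hkkt
  have h1 := hSf _ _ _ _ hv hk1
  have h2 := hSg _ _ _ _ hw hk2
  set a := LinearMap.adjoint A (y' - yb) with ha
  set p := LinearMap.adjoint B (z' - zb) with hp
  set d := LinearMap.adjoint B (z' - z) with hd
  have hrap : r = a + p := by
    rw [hr, ha, hp, map_sub, map_sub, ← hk3]; abel
  have e1 : -(A (x + σ • (LinearMap.adjoint A y' + (LinearMap.adjoint B z - c)))) - S (y' - y) -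
      -(A xb) = -(A ((x - xb) + σ • (a + p - d))) - S (y' - y) := by
    rw [← hrap, hr, hd, map_sub _ z' z,
      show LinearMap.adjoint A y' + (LinearMap.adjoint B z - c) =
        LinearMap.adjoint A y' + LinearMap.adjoint B z' - c -
          (LinearMap.adjoint B z' - LinearMap.adjoint B z) by abel]
    simp only [map_add A, map_sub A]; abel
  have e2 : -(B (x + σ • (LinearMap.adjoint B z' + (LinearMap.adjoint A y' - c)))) - T (z' - z) -
      -(B xb) = -(B ((x - xb) + σ • (a + p))) - T (z' - z) := by
    rw [← hrap, hr, show LinearMap.adjoint B z' + (LinearMap.adjoint A y' - c) =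
        LinearMap.adjoint A y' + LinearMap.adjoint B z' - c by abel]
    simp only [map_add B, map_sub B]; abel
  rw [e1, inner_neg_map_sub, ← ha] at h1
  rw [e2, inner_neg_map_sub, ← hp] at h2
  have h3 := inner_map_sub_self hS (y' - yb) (y - yb)
  have h4 := inner_map_sub_self hT (z' - zb) (z - zb)
  rw [sub_sub_sub_cancel_right] at h3 h4
  have h5 : LinearMap.adjoint B (z - zb) = p - d := by
    rw [hp, hd, ← map_sub, sub_sub_sub_cancel_left]
  have h6 : (τ * σ)⁻¹ * ‖x + (τ * σ) • r - xb‖ ^ 2 =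
      (τ * σ)⁻¹ * ‖x - xb‖ ^ 2 + 2 * ⟪x - xb, a + p⟫ + τ * σ * ‖a + p‖ ^ 2 := by
    rw [hrap, show x + (τ * σ) • (a + p) - xb = (x - xb) + (τ * σ) • (a + p) by abel,
      norm_add_sq_real, norm_smul, real_inner_smul_right, Real.norm_eq_abs, mul_pow, sq_abs]
    field_simp
  unfold lyap
  rw [h6, h5, ← hp, hrap, norm_sub_sq_real p d, norm_add_sq_real a p]
  have h7 : (⟪a, p⟫ : ℝ) = ⟪p, a⟫ := real_inner_comm _ _
  have h8 : (⟪d, p⟫ : ℝ) = ⟪p, d⟫ := real_inner_comm _ _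
  simp only [inner_add_left, inner_sub_left, inner_add_right, real_inner_smul_left,
    real_inner_self_eq_norm_sq, h7, h8] at h1 h2 h3 h4 ⊢
  linarith

/-- The cross term in `lyap_step` is controlled by the optimality conditions of two consecutive
`z`-subproblems. -/
lemma cross_term_bound {g : Z → EReal} {A : X →ₗ[ℝ] Y} {B : X →ₗ[ℝ] Z} {c : X}
    {σ τ : ℝ} {T : Z →ₗ[ℝ] Z} (hT : T.IsSymmetric) (hTpsd : ∀ w, 0 ≤ ⟪w, T w⟫)
    {Sg : Z →ₗ[ℝ] Z} (hSgpsd : ∀ w, 0 ≤ ⟪w, Sg w⟫) (hSg : SubMono g Sg)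
    {x₀ x : X} {y y' : Y} {z₀ z z' : Z} {r r' : X}
    (hr : r = LinearMap.adjoint A y + LinearMap.adjoint B z - c)
    (hr' : r' = LinearMap.adjoint A y' + LinearMap.adjoint B z' - c)
    (hx : x = x₀ + (τ * σ) • r)
    (hw : -(B (x₀ + σ • (LinearMap.adjoint B z + (LinearMap.adjoint A y - c)))) - T (z - z₀)
      ∈ subdiff g z)
    (hw' : -(B (x + σ • (LinearMap.adjoint B z' + (LinearMap.adjoint A y' - c)))) - T (z' - z)
      ∈ subdiff g z') :
    2 * σ * ⟪LinearMap.adjoint B (z' - z), r'⟫ + ⟪z' - z, T (z' - z)⟫ ≤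
      2 * σ * ((1 - τ) * ⟪LinearMap.adjoint B (z' - z), r⟫) + ⟪z - z₀, T (z - z₀)⟫ := by
  have h1 := (hSgpsd _).trans (hSg _ _ _ _ hw' hw)
  have e : -(B (x + σ • (LinearMap.adjoint B z' + (LinearMap.adjoint A y' - c)))) - T (z' - z) -
      (-(B (x₀ + σ • (LinearMap.adjoint B z + (LinearMap.adjoint A y - c)))) - T (z - z₀)) =
      -(B (σ • (r' - (1 - τ) • r))) - T ((z' - z) - (z - z₀)) := by
    rw [show LinearMap.adjoint B z' + (LinearMap.adjoint A y' - c) = r' by rw [hr']; abel,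
      show LinearMap.adjoint B z + (LinearMap.adjoint A y - c) = r by rw [hr]; abel, hx,
      show σ • (r' - (1 - τ) • r) = (x₀ + (τ * σ) • r + σ • r') - (x₀ + σ • r) by module,
      map_sub B, map_sub T (z' - z)]
    abel
  rw [e, inner_neg_map_sub, real_inner_comm (B.adjoint (z' - z))] at h1
  have h2 := inner_map_sub_self hT (z' - z) (z - z₀)
  have h3 := hTpsd ((z' - z) - (z - z₀))
  rw [real_inner_smul_right, inner_sub_right, real_inner_smul_right] at h1
  linarith

/-- The quantities that are forced to vanish along the sPADMM iteration. -/
def defect (A : X →ₗ[ℝ] Y) (B : X →ₗ[ℝ] Z) (c : X) (S : Y →ₗ[ℝ] Y) (T : Z →ₗ[ℝ] Z)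
    (Sf : Y →ₗ[ℝ] Y) (Sg : Z →ₗ[ℝ] Z) (yb : Y) (zb : Z) (y y' : Y) (z z' : Z) : ℝ :=
  ⟪y' - yb, Sf (y' - yb)⟫ + ⟪z' - zb, Sg (z' - zb)⟫ +
    ‖LinearMap.adjoint A y' + LinearMap.adjoint B z' - c‖ ^ 2 +
    ⟪y' - y, S (y' - y)⟫ + ⟪z' - z, T (z' - z)⟫ + ‖LinearMap.adjoint B (z' - z)‖ ^ 2

lemma lyap_nonneg (B : X →ₗ[ℝ] Z) {σ τ : ℝ} (hσ : 0 < σ) (hτ : 0 < τ) {S : Y →ₗ[ℝ] Y}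
    (hS : ∀ w, 0 ≤ ⟪w, S w⟫) {T : Z →ₗ[ℝ] Z} (hT : ∀ w, 0 ≤ ⟪w, T w⟫)
    (xb : X) (yb : Y) (zb : Z) (x : X) (y : Y) (z : Z) :
    0 ≤ lyap B σ τ S T xb yb zb x y z := by
  have := hS (y - yb)
  have := hT (z - zb)
  unfold lyap
  positivity

/-- Relative to any KKT point the Lyapunov function converges and the defect vanishes. -/
lemma lyap_converges {f : Y → EReal} {g : Z → EReal} {A : X →ₗ[ℝ] Y} {B : X →ₗ[ℝ] Z} {c : X}
    {σ τ : ℝ} (hσ : 0 < σ) (hτ : 0 < τ)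
    {S : Y →ₗ[ℝ] Y} (hS : S.IsSymmetric) (hSpsd : ∀ w, 0 ≤ ⟪w, S w⟫)
    {T : Z →ₗ[ℝ] Z} (hT : T.IsSymmetric) (hTpsd : ∀ w, 0 ≤ ⟪w, T w⟫)
    {Sf : Y →ₗ[ℝ] Y} (hSfpsd : ∀ w, 0 ≤ ⟪w, Sf w⟫) (hSf : SubMono f Sf)
    {Sg : Z →ₗ[ℝ] Z} (hSgpsd : ∀ w, 0 ≤ ⟪w, Sg w⟫) (hSg : SubMono g Sg)
    {x : ℕ → X} {y : ℕ → Y} {z : ℕ → Z} (hopt : SPADMMOptimality f g A B c σ τ S T x y z)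
    (hC : CondC τ x) {xb : X} {yb : Y} {zb : Z} (hkkt : IsKKT f g A B c xb yb zb) :
    (∃ l, Tendsto (fun k => lyap B σ τ S T xb yb zb (x k) (y k) (z k)) atTop (nhds l)) ∧
      Tendsto (fun k => defect A B c S T Sf Sg yb zb (y k) (y (k + 1)) (z k) (z (k + 1)))
        atTop (nhds 0) := by
  obtain ⟨hy, hz, hx⟩ := hopt
  set r : ℕ → X := fun k => LinearMap.adjoint A (y (k + 1)) + LinearMap.adjoint B (z (k + 1)) - c
    with hr
  set Φ : ℕ → ℝ := fun k => lyap B σ τ S T xb yb zb (x k) (y k) (z k) with hΦ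
  set D : ℕ → ℝ := fun k => defect A B c S T Sf Sg yb zb (y k) (y (k + 1)) (z k) (z (k + 1))
    with hD
  have hΦ0 : ∀ k, 0 ≤ Φ k := fun k => lyap_nonneg B hσ hτ hSpsd hTpsd _ _ _ _ _ _
  have hDeq : ∀ k, D k = ⟪y (k + 1) - yb, Sf (y (k + 1) - yb)⟫ +
      ⟪z (k + 1) - zb, Sg (z (k + 1) - zb)⟫ + ‖r k‖ ^ 2 +
      ⟪y (k + 1) - y k, S (y (k + 1) - y k)⟫ + ⟪z (k + 1) - z k, T (z (k + 1) - z k)⟫ +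
      ‖LinearMap.adjoint B (z (k + 1) - z k)‖ ^ 2 := fun k => rfl
  have hD0 : ∀ k, 0 ≤ D k := fun k => by
    rw [hDeq]
    have := hSfpsd (y (k + 1) - yb)
    have := hSgpsd (z (k + 1) - zb)
    have := hSpsd (y (k + 1) - y k)
    have := hTpsd (z (k + 1) - z k)
    positivity
  have hbound : ∀ k (m θ : ℝ), m ≤ 1 → m ≤ θ → m * D k ≤
      2 * ⟪y (k + 1) - yb, Sf (y (k + 1) - yb)⟫ + 2 * ⟪z (k + 1) - zb, Sg (z (k + 1) - zb)⟫ +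
      θ * ‖r k‖ ^ 2 + ⟪y (k + 1) - y k, S (y (k + 1) - y k)⟫ +
      ⟪z (k + 1) - z k, T (z (k + 1) - z k)⟫ +
      θ * ‖LinearMap.adjoint B (z (k + 1) - z k)‖ ^ 2 := by
    intro k m θ hm1 hmθ
    rw [hDeq]
    have h1 := hSfpsd (y (k + 1) - yb)
    have h2 := hSgpsd (z (k + 1) - zb)
    have h3 := mul_le_mul_of_nonneg_right hm1 (hSpsd (y (k + 1) - y k))
    have h4 := mul_le_mul_of_nonneg_right hm1 (hTpsd (z (k + 1) - z k))
    have h5 := mul_le_mul_of_nonneg_right hmθ (sq_nonneg ‖r k‖)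
    have h6 := mul_le_mul_of_nonneg_right hmθ
      (sq_nonneg ‖LinearMap.adjoint B (z (k + 1) - z k)‖)
    have h7 := mul_le_mul_of_nonneg_right hm1 h1
    have h8 := mul_le_mul_of_nonneg_right hm1 h2
    linarith
  have hstep : ∀ k, Φ (k + 1) + 2 * ⟪y (k + 1) - yb, Sf (y (k + 1) - yb)⟫ +
      2 * ⟪z (k + 1) - zb, Sg (z (k + 1) - zb)⟫ + (2 - τ) * σ * ‖r k‖ ^ 2 +
      ⟪y (k + 1) - y k, S (y (k + 1) - y k)⟫ + ⟪z (k + 1) - z k, T (z (k + 1) - z k)⟫ +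
      σ * ‖LinearMap.adjoint B (z (k + 1) - z k)‖ ^ 2 -
      2 * σ * ⟪LinearMap.adjoint B (z (k + 1) - z k), r k⟫ ≤ Φ k := by
    intro k
    have := lyap_step hσ hτ hS hT hSf hSg hkkt (hy k) (hz k) rfl
    rw [← hx k] at this
    exact this
  rcases hC with ⟨-, hτ'⟩ | ⟨-, hsum⟩
  · obtain ⟨C, δ, hC0, hδ, hCδ, hyoung⟩ := exists_young_weights (E := X) hτ hτ'
    set h : ℕ → ℝ := fun k => ⟪z (k + 1) - z k, T (z (k + 1) - z k)⟫ + C * σ * ‖r k‖ ^ 2 with hh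
    have hh0 : ∀ k, 0 ≤ h k := fun k => by
      have := hTpsd (z (k + 1) - z k)
      simp only [hh]; positivity
    set m := min 1 (δ * σ) with hm
    have hmpos : 0 < m := lt_min one_pos (mul_pos hδ hσ)
    have hdesc : ∀ k, (Φ (k + 1 + 1) + h (k + 1)) + m * D (k + 1) ≤ (Φ (k + 1) + h k) + 0 := by
      intro k
      have h1 := hstep (k + 1)
      have h2 := cross_term_bound hT hTpsd hSgpsd hSg (r := r k) (r' := r (k + 1)) rfl rfl (hx k)
        (hz k) (hz (k + 1))
      have h3 := mul_le_mul_of_nonneg_left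
        (hyoung (LinearMap.adjoint B (z (k + 1 + 1) - z (k + 1))) (r k)) hσ.le
      have h4 := hbound (k + 1) m (δ * σ) (min_le_left _ _) (min_le_right _ _)
      have h5 := mul_le_mul_of_nonneg_right hCδ
        (mul_nonneg hσ.le (sq_nonneg ‖r (k + 1)‖))
      simp only [hh]
      linarith
    obtain ⟨⟨l, hl⟩, hb⟩ := tendsto_of_perturbed_descent
      (a := fun k => Φ (k + 1) + h k) (b := fun k => m * D (k + 1)) (e := fun _ => 0)
      (fun k => add_nonneg (hΦ0 _) (hh0 _)) (fun k => mul_nonneg hmpos.le (hD0 _))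
      (fun _ => le_rfl) summable_zero hdesc
    have hDlim : Tendsto D atTop (nhds 0) := by
      rw [← tendsto_add_atTop_iff_nat 1]
      simpa [hmpos.ne'] using hb.const_mul m⁻¹
    have hhlim : Tendsto h atTop (nhds 0) := by
      refine squeeze_zero hh0 (g := fun k => (1 + C * σ) * D k) (fun k => ?_)
        (by simpa using hDlim.const_mul (1 + C * σ))
      have h1 := hSfpsd (y (k + 1) - yb)
      have h2 := hSgpsd (z (k + 1) - zb)
      have h3 := hSpsd (y (k + 1) - y k)
      have h4 := hTpsd (z (k + 1) - z k)
      have h5 := sq_nonneg ‖LinearMap.adjoint B (z (k + 1) - z k)‖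
      have h6 : ⟪z (k + 1) - z k, T (z (k + 1) - z k)⟫ ≤ D k := by
        rw [hDeq]; linarith [sq_nonneg ‖r k‖]
      have h7 : ‖r k‖ ^ 2 ≤ D k := by rw [hDeq]; linarith
      have h8 := mul_le_mul_of_nonneg_left h7 (mul_nonneg hC0 hσ.le)
      simp only [hh]
      linarith
    refine ⟨⟨l, ?_⟩, hDlim⟩
    rw [← tendsto_add_atTop_iff_nat 1]
    simpa using hl.sub hhlim
  · have hrsum : Summable fun k => (τ + 1) * σ * ‖r k‖ ^ 2 := by
      have : (fun k => (τ + 1) * σ * ‖r k‖ ^ 2) =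
          fun k => ((τ + 1) * σ / (τ * σ) ^ 2) * ‖x (k + 1) - x k‖ ^ 2 := by
        funext k
        rw [hx k, add_sub_cancel_left, norm_smul,
          Real.norm_of_nonneg (mul_pos hτ hσ).le]
        field_simp
        rfl
      rw [this]
      exact hsum.mul_left _
    set m := min 1 (σ / 2) with hm
    have hmpos : 0 < m := lt_min one_pos (half_pos hσ)
    have hdesc : ∀ k, Φ (k + 1) + m * D k ≤ Φ k + (τ + 1) * σ * ‖r k‖ ^ 2 := by
      intro k
      have h1 := hstep k
      have h2 := hbound k m (σ / 2) (min_le_left _ _) (min_le_right _ _)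
      have h3 := norm_sub_sq_real (LinearMap.adjoint B (z (k + 1) - z k)) ((2 : ℝ) • r k)
      rw [norm_smul, mul_pow, real_inner_smul_right, Real.norm_eq_abs, sq_abs] at h3
      have h4 := mul_nonneg hσ.le
        (sq_nonneg ‖LinearMap.adjoint B (z (k + 1) - z k) - (2 : ℝ) • r k‖)
      rw [h3] at h4
      have h5 := mul_nonneg hσ.le (sq_nonneg ‖r k‖)
      linarith
    obtain ⟨hl, hb⟩ := tendsto_of_perturbed_descent hΦ0 (fun k => mul_nonneg hmpos.le (hD0 k))
      (fun k => by positivity) hrsum hdesc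
    exact ⟨hl, by simpa [hmpos.ne'] using hb.const_mul m⁻¹⟩

/-- Positive definiteness makes the Lyapunov function and the defect control the distance to the
reference point. -/
lemma exists_dist_bound (A : X →ₗ[ℝ] Y) (B : X →ₗ[ℝ] Z) {c : X} {σ τ : ℝ}
    (hσ : 0 < σ) (hτ : 0 < τ)
    {S : Y →ₗ[ℝ] Y} (hSpsd : ∀ w, 0 ≤ ⟪w, S w⟫) {T : Z →ₗ[ℝ] Z} (hTpsd : ∀ w, 0 ≤ ⟪w, T w⟫)
    {Sf : Y →ₗ[ℝ] Y} (hSfpsd : ∀ w, 0 ≤ ⟪w, Sf w⟫) {Sg : Z →ₗ[ℝ] Z}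
    (hSgpsd : ∀ w, 0 ≤ ⟪w, Sg w⟫)
    (hfpd : ∀ w : Y, w ≠ 0 → 0 < ⟪w, (Sf + A ∘ₗ LinearMap.adjoint A + S) w⟫)
    (hgpd : ∀ w : Z, w ≠ 0 → 0 < ⟪w, (Sg + B ∘ₗ LinearMap.adjoint B + T) w⟫)
    (xb : X) {yb : Y} {zb : Z} (hc : LinearMap.adjoint A yb + LinearMap.adjoint B zb = c) :
    ∃ K : ℝ, ∀ (x : X) (y y' : Y) (z z' : Z),
      ‖x - xb‖ ^ 2 + ‖y' - yb‖ ^ 2 + ‖z' - zb‖ ^ 2 ≤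
        K * (defect A B c S T Sf Sg yb zb y y' z z' + lyap B σ τ S T xb yb zb x y' z') := by
  obtain ⟨m₁, hm₁, hf⟩ := exists_pos_mul_norm_sq_le _ hfpd
  obtain ⟨m₂, hm₂, hg⟩ := exists_pos_mul_norm_sq_le _ hgpd
  refine ⟨τ * σ + (3 + 2 / σ) / m₁ + (1 + 1 / σ) / m₂, fun x y y' z z' => ?_⟩
  set D := defect A B c S T Sf Sg yb zb y y' z z' with hD
  set Φ := lyap B σ τ S T xb yb zb x y' z' with hΦ
  have hf' := hf (y' - yb)
  have hg' := hg (z' - zb)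
  rw [inner_add_adjoint_add] at hf' hg'
  have h1 := hSfpsd (y' - yb)
  have h2 := hSgpsd (z' - zb)
  have h3 := hSpsd (y' - y)
  have h4 := hTpsd (z' - z)
  have h5 := hSpsd (y' - yb)
  have h6 := hTpsd (z' - zb)
  set r := LinearMap.adjoint A y' + LinearMap.adjoint B z' - c with hr
  set p := LinearMap.adjoint B (z' - zb) with hp
  have hA : LinearMap.adjoint A (y' - yb) = r - p := by
    rw [hr, hp, map_sub, map_sub, ← hc]; abel
  have hDeq : D = ⟪y' - yb, Sf (y' - yb)⟫ + ⟪z' - zb, Sg (z' - zb)⟫ + ‖r‖ ^ 2 +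
    ⟪y' - y, S (y' - y)⟫ + ⟪z' - z, T (z' - z)⟫ + ‖LinearMap.adjoint B (z' - z)‖ ^ 2 := rfl
  have hΦeq : Φ = (τ * σ)⁻¹ * ‖x - xb‖ ^ 2 + ⟪y' - yb, S (y' - yb)⟫ + ⟪z' - zb, T (z' - zb)⟫ +
    σ * ‖p‖ ^ 2 := rfl
  have h7 := sq_nonneg ‖r‖
  have h8 := sq_nonneg ‖LinearMap.adjoint B (z' - z)‖
  have h9 : 0 ≤ σ * ‖p‖ ^ 2 := by positivity
  have h10 : 0 ≤ (τ * σ)⁻¹ * ‖x - xb‖ ^ 2 := by positivity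
  have hD0 : 0 ≤ D := by linarith
  have hΦ0 : 0 ≤ Φ := by linarith
  have hxle : ‖x - xb‖ ^ 2 ≤ τ * σ * (D + Φ) := by
    calc ‖x - xb‖ ^ 2 = τ * σ * ((τ * σ)⁻¹ * ‖x - xb‖ ^ 2) := by field_simp
      _ ≤ _ := by gcongr; linarith
  have hple : ‖p‖ ^ 2 ≤ 1 / σ * (D + Φ) := by
    calc ‖p‖ ^ 2 = 1 / σ * (σ * ‖p‖ ^ 2) := by field_simp
      _ ≤ _ := by gcongr; linarith
  have hrp : ‖r - p‖ ^ 2 ≤ 2 * ‖r‖ ^ 2 + 2 * ‖p‖ ^ 2 := by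
    have e1 := norm_sub_sq_real r p
    have e2 := norm_add_sq_real r p
    linarith [sq_nonneg ‖r + p‖]
  have hzle : ‖z' - zb‖ ^ 2 ≤ (1 + 1 / σ) / m₂ * (D + Φ) := by
    rw [div_mul_eq_mul_div, le_div_iff₀ hm₂]
    linarith
  have hyle : ‖y' - yb‖ ^ 2 ≤ (3 + 2 / σ) / m₁ * (D + Φ) := by
    rw [div_mul_eq_mul_div, le_div_iff₀ hm₁]
    rw [hA] at hf'
    have e : 2 / σ * (D + Φ) = 2 * (1 / σ * (D + Φ)) := by ring
    linarith
  linarith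

/-- A sequence satisfying the sPADMM optimality conditions converges to a KKT point. -/
lemma SPADMMOptimality.tendsto {f : Y → EReal} {g : Z → EReal} {A : X →ₗ[ℝ] Y} {B : X →ₗ[ℝ] Z}
    {c : X} {σ τ : ℝ} {S : Y →ₗ[ℝ] Y} {T : Z →ₗ[ℝ] Z}
    {x : ℕ → X} {y : ℕ → Y} {z : ℕ → Z} (hopt : SPADMMOptimality f g A B c σ τ S T x y z)
    (hf : LowerSemicontinuous f) (hg : LowerSemicontinuous g) (hσ : 0 < σ) (hτ : 0 < τ)
    (hS : S.IsSymmetric) (hSpsd : ∀ w, 0 ≤ ⟪w, S w⟫)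
    (hT : T.IsSymmetric) (hTpsd : ∀ w, 0 ≤ ⟪w, T w⟫)
    {Sf : Y →ₗ[ℝ] Y} (hSfpsd : ∀ w, 0 ≤ ⟪w, Sf w⟫) (hSf : SubMono f Sf)
    {Sg : Z →ₗ[ℝ] Z} (hSgpsd : ∀ w, 0 ≤ ⟪w, Sg w⟫) (hSg : SubMono g Sg)
    (hfpd : ∀ w : Y, w ≠ 0 → 0 < ⟪w, (Sf + A ∘ₗ LinearMap.adjoint A + S) w⟫)
    (hgpd : ∀ w : Z, w ≠ 0 → 0 < ⟪w, (Sg + B ∘ₗ LinearMap.adjoint B + T) w⟫)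
    (hC : CondC τ x) {xb : X} {yb : Y} {zb : Z} (hkkt : IsKKT f g A B c xb yb zb) :
    ∃ xinf : X, ∃ yinf : Y, ∃ zinf : Z,
      Tendsto (fun k : ℕ => (x k, y k, z k)) atTop (nhds (xinf, yinf, zinf)) ∧
      IsKKT f g A B c xinf yinf zinf := by
  have hconv := fun {xb yb zb} (h : IsKKT f g A B c xb yb zb) =>
    lyap_converges hσ hτ hS hSpsd hT hTpsd hSfpsd hSf hSgpsd hSg hopt hC h
  have hAcont := A.continuous_of_finiteDimensional
  have hBcont := B.continuous_of_finiteDimensional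
  have hA'cont := (LinearMap.adjoint A).continuous_of_finiteDimensional
  have hB'cont := (LinearMap.adjoint B).continuous_of_finiteDimensional
  have hScont := S.continuous_of_finiteDimensional
  have hTcont := T.continuous_of_finiteDimensional
  obtain ⟨⟨l, hl⟩, hD⟩ := hconv hkkt
  -- the residuals vanish
  have hres : ∀ {a : ℕ → ℝ}, (∀ k, 0 ≤ a k) →
      (∀ k, a k ≤ defect A B c S T Sf Sg yb zb (y k) (y (k + 1)) (z k) (z (k + 1))) →
      Tendsto a atTop (nhds 0) := fun h0 h1 => squeeze_zero h0 h1 hD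
  have hnn := fun k => And.intro (hSfpsd (y (k + 1) - yb)) <| And.intro (hSgpsd (z (k + 1) - zb)) <|
    And.intro (hSpsd (y (k + 1) - y k)) <| And.intro (hTpsd (z (k + 1) - z k)) <| And.intro
    (sq_nonneg ‖LinearMap.adjoint A (y (k + 1)) + LinearMap.adjoint B (z (k + 1)) - c‖)
    (sq_nonneg ‖LinearMap.adjoint B (z (k + 1) - z k)‖)
  have hr : Tendsto (fun k => LinearMap.adjoint A (y (k + 1)) + LinearMap.adjoint B (z (k + 1)) - c)
      atTop (nhds 0) := by
    rw [tendsto_zero_iff_norm_tendsto_zero]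
    simpa using (hres (fun k => (hnn k).2.2.2.2.1) fun k => by
      unfold defect; obtain ⟨_, _, _, _, _, _⟩ := hnn k; linarith).sqrt
  have hBz : Tendsto (fun k => LinearMap.adjoint B (z (k + 1) - z k)) atTop (nhds 0) := by
    rw [tendsto_zero_iff_norm_tendsto_zero]
    simpa only [Real.sqrt_sq (norm_nonneg _), Real.sqrt_zero] using
      (hres (fun k => (hnn k).2.2.2.2.2) fun k => by
        unfold defect; obtain ⟨_, _, _, _, _, _⟩ := hnn k; linarith).sqrt
  have hSy : Tendsto (fun k => S (y (k + 1) - y k)) atTop (nhds 0) :=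
    tendsto_map_zero_of_inner hS hSpsd (hres (fun k => (hnn k).2.2.1) fun k => by
      unfold defect; obtain ⟨_, _, _, _, _, _⟩ := hnn k; linarith)
  have hTz : Tendsto (fun k => T (z (k + 1) - z k)) atTop (nhds 0) :=
    tendsto_map_zero_of_inner hT hTpsd (hres (fun k => (hnn k).2.2.2.1) fun k => by
      unfold defect; obtain ⟨_, _, _, _, _, _⟩ := hnn k; linarith)
  -- the iterates are bounded, hence have a cluster point
  obtain ⟨K, hK⟩ := exists_dist_bound A B hσ hτ hSpsd hTpsd hSfpsd hSgpsd hfpd hgpd xb hkkt.2.2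
  have hlim := (hD.add ((tendsto_add_atTop_iff_nat 1).2 hl)).const_mul K
  obtain ⟨R, hR⟩ := hlim.bddAbove_range
  have hbdd : ∀ k, (x (k + 1), y (k + 1), z (k + 1)) ∈ Metric.closedBall (xb, yb, zb) (R + 1) := by
    intro k
    have h1 := (hK (x (k + 1)) (y k) (y (k + 1)) (z k) (z (k + 1))).trans (hR ⟨k, rfl⟩)
    rw [Metric.mem_closedBall, Prod.dist_eq, Prod.dist_eq, dist_eq_norm, dist_eq_norm,
      dist_eq_norm]
    have h2 := sq_nonneg (‖x (k + 1) - xb‖ - 1)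
    have h3 := sq_nonneg (‖y (k + 1) - yb‖ - 1)
    have h4 := sq_nonneg (‖z (k + 1) - zb‖ - 1)
    have h5 := sq_nonneg ‖x (k + 1) - xb‖
    have h6 := sq_nonneg ‖y (k + 1) - yb‖
    have h7 := sq_nonneg ‖z (k + 1) - zb‖
    refine max_le ?_ (max_le ?_ ?_) <;> nlinarith
  obtain ⟨⟨xi, yi, zi⟩, -, φ, hφ, hsub⟩ :=
    tendsto_subseq_of_bounded Metric.isBounded_closedBall hbdd
  have hxi : Tendsto (fun n => x (φ n + 1)) atTop (nhds xi) := (Prod.tendsto_iff _ _ |>.1 hsub).1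
  have hyzi := (Prod.tendsto_iff _ _ |>.1 hsub).2
  have hyi : Tendsto (fun n => y (φ n + 1)) atTop (nhds yi) := (Prod.tendsto_iff _ _ |>.1 hyzi).1
  have hzi : Tendsto (fun n => z (φ n + 1)) atTop (nhds zi) := (Prod.tendsto_iff _ _ |>.1 hyzi).2
  have hφ' := hφ.tendsto_atTop
  have hrφ := hr.comp hφ'
  have hBzφ := hBz.comp hφ'
  have hxprev : ∀ k, x k = x (k + 1) - (τ * σ) •
      (LinearMap.adjoint A (y (k + 1)) + LinearMap.adjoint B (z (k + 1)) - c) := fun k => by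
    rw [hopt.x_step k]; abel
  have hxφ : Tendsto (fun n => x (φ n)) atTop (nhds xi) := by
    have := hxi.sub (hrφ.const_smul (τ * σ))
    rw [smul_zero, sub_zero] at this
    exact this.congr fun n => (hxprev (φ n)).symm
  have hkkt' : IsKKT f g A B c xi yi zi := by
    refine ⟨?_, ?_, ?_⟩
    · refine mem_subdiff_of_tendsto hf hyi ?_ fun n => hopt.y_mem (φ n)
      have h1 := hxφ.add ((hrφ.sub hBzφ).const_smul σ)
      have h2 := (((hAcont.tendsto _).comp h1).neg).sub (hSy.comp hφ')
      simp only [sub_zero, smul_zero, add_zero] at h2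
      refine h2.congr fun n => ?_
      simp only [Function.comp_apply]
      congr 4
      rw [map_sub]; abel_nf
    · refine mem_subdiff_of_tendsto hg hzi ?_ fun n => hopt.z_mem (φ n)
      have h1 := hxφ.add (hrφ.const_smul σ)
      have h2 := (((hBcont.tendsto _).comp h1).neg).sub (hTz.comp hφ')
      simp only [sub_zero, smul_zero, add_zero] at h2
      refine h2.congr fun n => ?_
      simp only [Function.comp_apply]
      congr 4
      abel_nf
    · have h1 := (((hA'cont.tendsto _).comp hyi).add ((hB'cont.tendsto _).comp hzi)).sub
        (tendsto_const_nhds (x := c))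
      exact sub_eq_zero.1 (tendsto_nhds_unique h1 hrφ)
  -- the Lyapunov function relative to the cluster point tends to zero
  obtain ⟨⟨l', hl'⟩, hD'⟩ := hconv hkkt'
  have hl'' := (tendsto_add_atTop_iff_nat 1).2 hl'
  have hzero : Tendsto (fun n => lyap B σ τ S T xi yi zi (x (φ n + 1)) (y (φ n + 1)) (z (φ n + 1)))
      atTop (nhds 0) := by
    have hcont : Continuous fun p : X × Y × Z => lyap B σ τ S T xi yi zi p.1 p.2.1 p.2.2 := by
      unfold lyap; fun_prop
    have h1 := (hcont.tendsto (xi, yi, zi)).comp hsub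
    have h2 : lyap B σ τ S T xi yi zi xi yi zi = 0 := by simp [lyap]
    rw [h2] at h1
    exact h1
  obtain rfl : l' = 0 := tendsto_nhds_unique (hl''.comp hφ') hzero
  obtain ⟨K', hK'⟩ := exists_dist_bound A B hσ hτ hSpsd hTpsd hSfpsd hSgpsd hfpd hgpd xi hkkt'.2.2
  have hlim' := (hD'.add hl'').const_mul K'
  rw [add_zero, mul_zero] at hlim'
  have hnorm : ∀ {a : ℕ → ℝ}, (∀ k, 0 ≤ a k) →
      (∀ k, a k ^ 2 ≤ ‖x (k + 1) - xi‖ ^ 2 + ‖y (k + 1) - yi‖ ^ 2 + ‖z (k + 1) - zi‖ ^ 2) →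
      Tendsto a atTop (nhds 0) := by
    intro a h0 h
    have := squeeze_zero (fun k => sq_nonneg (a k))
      (fun k => (h k).trans (hK' _ (y k) _ (z k) _)) hlim'
    simpa [Real.sqrt_sq (h0 _)] using this.sqrt
  refine ⟨xi, yi, zi, Tendsto.prodMk_nhds ?_ (Tendsto.prodMk_nhds ?_ ?_), hkkt'⟩
  all_goals
    rw [← tendsto_add_atTop_iff_nat 1, tendsto_iff_norm_sub_tendsto_zero]
    refine hnorm (fun _ => norm_nonneg _) fun k => ?_
    linarith [sq_nonneg ‖x (k + 1) - xi‖, sq_nonneg ‖y (k + 1) - yi‖, sq_nonneg ‖z (k + 1) - zi‖]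

end Convergence

/-- **Theorem 1(d).**  If the KKT system has a solution, Condition (C) holds, and
`Σ_f + A A* + S` and `Σ_g + B B* + T` are positive definite, then every sPADMM subproblem
has a unique optimal solution and the whole sequence `{(x^k, y^k, z^k)}` converges to a
solution of the KKT system. -/
theorem stmt_19
    (f : Y → EReal) (g : Z → EReal)
    (hf : ProperConvexLsc f) (hg : ProperConvexLsc g)
    (A : X →ₗ[ℝ] Y) (B : X →ₗ[ℝ] Z) (c : X)
    (σ τ : ℝ) (hσ : 0 < σ) (hτ : 0 < τ)
    (S : Y →ₗ[ℝ] Y) (hSsym : S.IsSymmetric) (hSpsd : ∀ w : Y, 0 ≤ ⟪w, S w⟫)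
    (T : Z →ₗ[ℝ] Z) (hTsym : T.IsSymmetric) (hTpsd : ∀ w : Z, 0 ≤ ⟪w, T w⟫)
    (Sf : Y →ₗ[ℝ] Y) (hSfsym : Sf.IsSymmetric) (hSfpsd : ∀ w : Y, 0 ≤ ⟪w, Sf w⟫)
    (hSfmono : SubMono f Sf)
    (Sg : Z →ₗ[ℝ] Z) (hSgsym : Sg.IsSymmetric) (hSgpsd : ∀ w : Z, 0 ≤ ⟪w, Sg w⟫)
    (hSgmono : SubMono g Sg)
    (xb : X) (yb : Y) (zb : Z) (hkkt : IsKKT f g A B c xb yb zb)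
    (x : ℕ → X) (y : ℕ → Y) (z : ℕ → Z)
    (hseq : IsSPADMM f g A B c σ τ S T x y z)
    (hC : CondC τ x)
    (hfpd : ∀ w : Y, w ≠ 0 → 0 < ⟪w, (Sf + A ∘ₗ (LinearMap.adjoint A) + S) w⟫)
    (hgpd : ∀ w : Z, w ≠ 0 → 0 < ⟪w, (Sg + B ∘ₗ (LinearMap.adjoint B) + T) w⟫) :
    (∀ k : ℕ,
      (∃! w : Y, ∀ w' : Y,
        ysub f g A B c σ S (x k) (y k) (z k) w ≤ ysub f g A B c σ S (x k) (y k) (z k) w') ∧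
      (∃! w : Z, ∀ w' : Z,
        zsub f g A B c σ T (x k) (y (k + 1)) (z k) w
          ≤ zsub f g A B c σ T (x k) (y (k + 1)) (z k) w')) ∧
    ∃ xinf : X, ∃ yinf : Y, ∃ zinf : Z,
      Tendsto (fun k : ℕ => (x k, y k, z k)) atTop (nhds (xinf, yinf, zinf)) ∧
      IsKKT f g A B c xinf yinf zinf := by
  obtain ⟨hfy0, hgz0, hymin, hzmin, hx⟩ := hseq
  have hyb := ne_top_of_mem_subdiff hf hkkt.1
  have hzb := ne_top_of_mem_subdiff hg hkkt.2.1
  have hysub : ∀ k, g (z k) ≠ ⊤ → ∀ u : Y,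
      (∀ w, ysub f g A B c σ S (x k) (y k) (z k) u ≤ ysub f g A B c σ S (x k) (y k) (z k) w) →
      f u ≠ ⊤ ∧ -(A (x k + σ • (LinearMap.adjoint A u + (LinearMap.adjoint B (z k) - c))))
        - S (u - y k) ∈ subdiff f u := by
    intro k hz u hu
    lift g (z k) to ℝ using ⟨hz, hg.2.1 _⟩ with G hG
    simp only [ysub_eq f A B c σ S (x k) (y k) hG.symm] at hu
    have hu' := ne_top_of_add_coe_le hyb (hu yb)
    exact ⟨hu', mem_subdiff_of_prox_isMin hf A σ hSsym _ _ _ G hu' hu⟩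
  have hzsub : ∀ k, f (y (k + 1)) ≠ ⊤ → ∀ u : Z,
      (∀ w, zsub f g A B c σ T (x k) (y (k + 1)) (z k) u ≤
        zsub f g A B c σ T (x k) (y (k + 1)) (z k) w) →
      g u ≠ ⊤ ∧ -(B (x k + σ • (LinearMap.adjoint B u + (LinearMap.adjoint A (y (k + 1)) - c))))
        - T (u - z k) ∈ subdiff g u := by
    intro k hy u hu
    lift f (y (k + 1)) to ℝ using ⟨hy, hf.2.1 _⟩ with G hG
    simp only [zsub_eq g A B c σ T (x k) (z k) hG.symm] at hu
    have hu' := ne_top_of_add_coe_le hzb (hu zb)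
    exact ⟨hu', mem_subdiff_of_prox_isMin hg B σ hTsym _ _ _ G hu' hu⟩
  have hgz : ∀ k, g (z k) ≠ ⊤ := by
    intro k
    induction k with
    | zero => exact hgz0
    | succ k ih => exact (hzsub k (hysub k ih _ (hymin k)).1 _ (hzmin k)).1
  have hfy : ∀ k, f (y (k + 1)) ≠ ⊤ := fun k => (hysub k (hgz k) _ (hymin k)).1
  refine ⟨fun k => ⟨⟨y (k + 1), hymin k, fun u hu => ?_⟩, ⟨z (k + 1), hzmin k, fun u hu => ?_⟩⟩, ?_⟩
  · exact eq_of_prox_mem_subdiff A hσ hSpsd hSfpsd hSfmono hfpd _ _ _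
      (hysub k (hgz k) u hu).2 (hysub k (hgz k) _ (hymin k)).2
  · exact eq_of_prox_mem_subdiff B hσ hTpsd hSgpsd hSgmono hgpd _ _ _
      (hzsub k (hfy k) u hu).2 (hzsub k (hfy k) _ (hzmin k)).2
  · have hopt : SPADMMOptimality f g A B c σ τ S T x y z :=
      ⟨fun k => (hysub k (hgz k) _ (hymin k)).2, fun k => (hzsub k (hfy k) _ (hzmin k)).2, hx⟩
    exact hopt.tendsto hf.2.2.2 hg.2.2.2 hσ hτ hSsym hSpsd hTsym hTpsd hSfpsd hSfmono hSgpsd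
      hSgmono hfpd hgpd hC hkkt
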